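/- arXiv:1808.03707 — 2 statements merged into one kernel-verified Lean document; each statement's English description precedes it below -/
import Mathlib

section
/- Let μ be a positive Borel measure on ℝ all of whose moments ∫ x^α dμ (α ∈ ℕ₀) are finite and such that every nonzero real polynomial p satisfies ∫ p(x)² dμ > 0, and let (p_k)_{k≥0} be the orthonormal polynomials of μ, i.e. deg p_k = k, ∫ p_j p_k dμ = δ_{jk}, with positive leading coefficients. Then for each n ≥ 1: (i) p_n has n distinct real roots x₁ < … < x_n, all lying in the interior of the convex hull of the support of μ; (ii) the unique real numbers w₁,…,w_n solving the linear system Σ_{q=1}^n p_j(x_q) w_q = √b₀ if j = 0 and = 0 if j = 1,…,n−1, where b₀ = μ(ℝ), are all strictly positive; and (iii) ∫ p dμ = Σ_{q=1}^n w_q p(x_q) for every real polynomial p of degree at most 2n−1. -/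
open MeasureTheory Polynomial

section Moments

variable {μ : Measure ℝ}

theorem integrable_polynomial_eval (hmom : ∀ α : ℕ, Integrable (fun x : ℝ => x ^ α) μ)
    (p : ℝ[X]) : Integrable (fun x => p.eval x) μ := by
  simp only [eval_eq_sum_range]
  exact integrable_finsetSum _ fun i _ => (hmom i).const_mul _

/-- Integration of polynomials against a measure with finite moments, as a linear functional. -/
noncomputable def momentFunctional (hmom : ∀ α : ℕ, Integrable (fun x : ℝ => x ^ α) μ) :
    ℝ[X] →ₗ[ℝ] ℝ where
  toFun p := ∫ x, p.eval x ∂μ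
  map_add' p q := by
    simp only [eval_add]
    exact integral_add (integrable_polynomial_eval hmom p) (integrable_polynomial_eval hmom q)
  map_smul' c p := by
    simp only [eval_smul, smul_eq_mul, RingHom.id_apply, integral_const_mul]

theorem momentFunctional_apply (hmom : ∀ α : ℕ, Integrable (fun x : ℝ => x ^ α) μ) (p : ℝ[X]) :
    momentFunctional hmom p = ∫ x, p.eval x ∂μ := rfl

/-- A polynomial orthogonal to all polynomials of smaller degree has no nonconstant factor
that is nonnegative almost everywhere. -/
theorem false_of_orthogonal_of_factor_nonneg
    (hmom : ∀ α : ℕ, Integrable (fun x : ℝ => x ^ α) μ)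
    (hpd : ∀ p : ℝ[X], p ≠ 0 → 0 < ∫ x, (p.eval x) ^ 2 ∂μ)
    {p h g : ℝ[X]} (hp0 : p ≠ 0)
    (horth : ∀ q : ℝ[X], q.degree < p.degree → momentFunctional hmom (p * q) = 0)
    (hp : p = h * g) (hh : 0 < h.degree) (hpos : ∀ᵐ x ∂μ, 0 ≤ h.eval x) : False := by
  have hg0 : g ≠ 0 := by rintro rfl; simp [hp] at hp0
  have hgd : g.degree < p.degree := by
    rw [hp, degree_mul, degree_eq_natDegree hg0,
      degree_eq_natDegree (ne_zero_of_degree_gt hh)] at *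
    norm_cast at *
    omega
  have h0 := horth g hgd
  rw [momentFunctional_apply] at h0
  have hnn : 0 ≤ᵐ[μ] fun x => (p * g).eval x := by
    filter_upwards [hpos] with x hx
    simp only [hp, eval_mul, Pi.zero_apply, mul_assoc]
    exact mul_nonneg hx (mul_self_nonneg _)
  have hae := (integral_eq_zero_iff_of_nonneg_ae hnn (integrable_polynomial_eval hmom _)).1 h0
  refine (hpd p hp0).ne' (integral_eq_zero_of_ae ?_)
  filter_upwards [hae] with x hx
  simp only [eval_mul, Pi.zero_apply] at hx ⊢
  rcases mul_eq_zero.1 hx with hx | hx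
  · simp [hx]
  · simp [hp, hx]

theorem false_of_orthogonal_of_factor_sign
    (hmom : ∀ α : ℕ, Integrable (fun x : ℝ => x ^ α) μ)
    (hpd : ∀ p : ℝ[X], p ≠ 0 → 0 < ∫ x, (p.eval x) ^ 2 ∂μ)
    {p h : ℝ[X]} (hp0 : p ≠ 0)
    (horth : ∀ q : ℝ[X], q.degree < p.degree → momentFunctional hmom (p * q) = 0)
    (hp : h ∣ p) (hh : 0 < h.degree)
    (hsign : (∀ᵐ x ∂μ, 0 ≤ h.eval x) ∨ ∀ᵐ x ∂μ, h.eval x ≤ 0) : False := by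
  obtain ⟨g, hg⟩ := hp
  rcases hsign with hs | hs
  · exact false_of_orthogonal_of_factor_nonneg hmom hpd hp0 horth hg hh hs
  · refine false_of_orthogonal_of_factor_nonneg hmom hpd hp0 horth (h := -h) (g := -g)
      (by rw [hg]; ring) (by rwa [degree_neg]) ?_
    filter_upwards [hs] with x hx
    simpa using hx

end Moments

/-- A linear functional vanishing on a degree-graded family of polynomials up to degree `n`
vanishes on all polynomials of degree less than `n`. -/
theorem linearMap_eq_zero_of_degree_lt {P : ℕ → ℝ[X]}
    (hdeg : ∀ j : ℕ, (P j).degree = (j : WithBot ℕ)) (L : ℝ[X] →ₗ[ℝ] ℝ) :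
    ∀ n : ℕ, (∀ j < n, L (P j) = 0) → ∀ p : ℝ[X], p.degree < (n : WithBot ℕ) → L p = 0 := by
  intro n
  induction n with
  | zero =>
    intro _ p hp
    have : p = 0 := by
      rw [← degree_eq_bot]
      exact Nat.WithBot.lt_zero_iff.1 (by simpa using hp)
    simp [this]
  | succ k ih =>
    intro hL p hp
    have hk : (P k).coeff k ≠ 0 := by
      have h := leadingCoeff_ne_zero.2 (ne_zero_of_degree_gt (n := ⊥) (p := P k) (by simp [hdeg k]))
      rwa [leadingCoeff, natDegree_eq_of_degree_eq_some (hdeg k)] at h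
    set c := p.coeff k / (P k).coeff k
    have hlt : (p - c • P k).degree < (k : WithBot ℕ) := by
      rw [degree_lt_iff_coeff_zero]
      intro m hm
      rcases hm.eq_or_lt with rfl | hm
      · simp [c, hk]
      · have h1 : p.coeff m = 0 := (degree_lt_iff_coeff_zero _ _).1 hp m hm
        have h2 : (P k).coeff m = 0 :=
          coeff_eq_zero_of_degree_lt (by rw [hdeg k]; exact_mod_cast hm)
        simp [h1, h2]
    have := ih (fun j hj => hL j (by omega)) _ hlt
    simpa [hL k (by omega)] using this

theorem natDegree_div_le_sub {K : Type*} [Field K] (p : K[X]) {q : K[X]} (hq : q ≠ 0) :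
    (p / q).natDegree ≤ p.natDegree - q.natDegree := by
  rw [div_def]
  refine (natDegree_C_mul_le _ _).trans ?_
  rw [natDegree_divByMonic _ (monic_mul_leadingCoeff_inv hq),
    natDegree_mul_leadingCoeff_inv _ hq]

theorem sign_of_forall_eval_ne_zero {h : ℝ[X]} (hne : ∀ x, h.eval x ≠ 0) :
    (∀ x, 0 ≤ h.eval x) ∨ ∀ x, h.eval x ≤ 0 := by
  by_contra! hcon
  obtain ⟨⟨a, ha⟩, b, hb⟩ := hcon
  obtain ⟨c, hc⟩ := mem_range_of_exists_le_of_exists_ge h.continuous ⟨a, ha.le⟩ ⟨b, hb.le⟩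
  exact hne c hc

/-- A point outside the interior of the convex hull of a set has the set on one side. -/
theorem forall_le_or_forall_ge_of_notMem_interior_convexHull {S : Set ℝ} {a : ℝ}
    (ha : a ∉ interior (convexHull ℝ S)) : (∀ x ∈ S, a ≤ x) ∨ ∀ x ∈ S, x ≤ a := by
  by_contra! hcon
  obtain ⟨⟨x, hx, hxa⟩, y, hy, hya⟩ := hcon
  refine ha (mem_interior.2 ⟨Set.Ioo x y, ?_, isOpen_Ioo, hxa, hya⟩)
  exact Set.Ioo_subset_Icc_self.trans ((convex_convexHull ℝ S).ordConnected.out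
    (subset_convexHull ℝ S hx) (subset_convexHull ℝ S hy))

section Roots

variable {μ : Measure ℝ} {p : ℝ[X]}

theorem splits_of_orthogonal
    (hmom : ∀ α : ℕ, Integrable (fun x : ℝ => x ^ α) μ)
    (hpd : ∀ p : ℝ[X], p ≠ 0 → 0 < ∫ x, (p.eval x) ^ 2 ∂μ) (hp0 : p ≠ 0)
    (horth : ∀ q : ℝ[X], q.degree < p.degree → momentFunctional hmom (p * q) = 0) :
    p.Splits := by
  obtain ⟨u, hu⟩ := UniqueFactorizationMonoid.factors_prod hp0
  rw [← hu]
  refine (Splits.multisetProd fun g hgf => Splits.of_degree_eq_one ?_).mul u.isUnit.splits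
  have hg := UniqueFactorizationMonoid.irreducible_of_factor g hgf
  have hgp := UniqueFactorizationMonoid.dvd_of_mem_factors hgf
  by_contra hd
  have hpos : 0 < g.degree := hg.degree_pos
  have hne : ∀ x, g.eval x ≠ 0 := fun x hx => hd (degree_eq_one_of_irreducible_of_root hg hx)
  exact false_of_orthogonal_of_factor_sign hmom hpd hp0 horth hgp hpos
    ((sign_of_forall_eval_ne_zero hne).imp (.of_forall) (.of_forall))

theorem nodup_roots_of_orthogonal
    (hmom : ∀ α : ℕ, Integrable (fun x : ℝ => x ^ α) μ)
    (hpd : ∀ p : ℝ[X], p ≠ 0 → 0 < ∫ x, (p.eval x) ^ 2 ∂μ) (hp0 : p ≠ 0)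
    (horth : ∀ q : ℝ[X], q.degree < p.degree → momentFunctional hmom (p * q) = 0) :
    p.roots.Nodup := by
  refine Multiset.nodup_iff_count_le_one.2 fun a => ?_
  by_contra! hlt
  rw [count_roots] at hlt
  refine false_of_orthogonal_of_factor_sign hmom hpd hp0 horth
    ((le_rootMultiplicity_iff hp0).1 hlt) (by simp) (Or.inl (.of_forall fun x => ?_))
  simpa using sq_nonneg (x - a)

theorem root_mem_interior_of_orthogonal
    (hmom : ∀ α : ℕ, Integrable (fun x : ℝ => x ^ α) μ)
    (hpd : ∀ p : ℝ[X], p ≠ 0 → 0 < ∫ x, (p.eval x) ^ 2 ∂μ) (hp0 : p ≠ 0)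
    (horth : ∀ q : ℝ[X], q.degree < p.degree → momentFunctional hmom (p * q) = 0)
    {a : ℝ} (ha : p.eval a = 0) :
    a ∈ interior (convexHull ℝ μ.support) := by
  by_contra hcon
  refine false_of_orthogonal_of_factor_sign hmom hpd hp0 horth (dvd_iff_isRoot.2 ha) (by simp)
    ((forall_le_or_forall_ge_of_notMem_interior_convexHull hcon).imp (fun h => ?_) fun h => ?_)
  all_goals
    filter_upwards [μ.support_mem_ae] with x hx
    simpa using h x hx

end Roots

theorem stmt_0 (μ : Measure ℝ)
    (hmom : ∀ α : ℕ, Integrable (fun x : ℝ => x ^ α) μ)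
    (hpd : ∀ p : Polynomial ℝ, p ≠ 0 → 0 < ∫ x, (p.eval x) ^ 2 ∂μ)
    (P : ℕ → Polynomial ℝ)
    (hdeg : ∀ j : ℕ, (P j).degree = (j : WithBot ℕ))
    (horth : ∀ j l : ℕ, ∫ x, (P j).eval x * (P l).eval x ∂μ = if j = l then 1 else 0)
    (hlead : ∀ j : ℕ, 0 < (P j).leadingCoeff)
    (n : ℕ) (hn : 1 ≤ n) :
    ∃ x : Fin n → ℝ, StrictMono x ∧ (∀ q, (P n).eval (x q) = 0) ∧
      (∀ q, x q ∈ interior (convexHull ℝ {y : ℝ | ∀ U ∈ nhds y, 0 < μ U})) ∧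
      (∃! w : Fin n → ℝ, ∀ j : Fin n,
          ∑ q, (P (j : ℕ)).eval (x q) * w q =
            if (j : ℕ) = 0 then Real.sqrt (μ Set.univ).toReal else 0) ∧
      ∀ w : Fin n → ℝ,
        (∀ j : Fin n, ∑ q, (P (j : ℕ)).eval (x q) * w q =
            if (j : ℕ) = 0 then Real.sqrt (μ Set.univ).toReal else 0) →
        (∀ q, 0 < w q) ∧
        ∀ p : Polynomial ℝ, p.natDegree ≤ 2 * n - 1 →
          ∫ x', p.eval x' ∂μ = ∑ q, w q * p.eval (x q) := by
  set L := momentFunctional hmom with hL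
  have hP0 : ∀ j, P j ≠ 0 := fun j => leadingCoeff_ne_zero.1 (hlead j).ne'
  have hLP : ∀ j l, L (P j * P l) = if j = l then 1 else 0 := fun j l => by
    simpa [hL, momentFunctional_apply] using horth j l
  have hPn : ∀ q : ℝ[X], q.degree < (P n).degree → L (P n * q) = 0 := fun q hq => by
    rw [hdeg n] at hq
    refine linearMap_eq_zero_of_degree_lt hdeg (L ∘ₗ LinearMap.mulLeft ℝ (P n)) n
      (fun j hj => ?_) q hq
    simp [hLP, hj.ne']
  have hLPj : ∀ j, L (P j) = if j = 0 then Real.sqrt (μ Set.univ).toReal else 0 := fun j => by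
    obtain ⟨c, hc⟩ : ∃ c, P 0 = C c := ⟨_, eq_C_of_degree_eq_zero (hdeg 0)⟩
    have hc0 : 0 < c := by simpa [hc] using hlead 0
    have hmul : ∀ q, L (P 0 * q) = c * L q := fun q => by
      rw [hc, ← smul_eq_C_mul, map_smul, smul_eq_mul]
    split_ifs with hj
    · subst hj
      have h1 : c * L (P 0) = 1 := by rw [← hmul, hLP, if_pos rfl]
      have h2 : L (P 0) = (μ Set.univ).toReal * c := by
        simp [hL, momentFunctional_apply, hc, Measure.real]
      symm
      rw [Real.sqrt_eq_iff_mul_self_eq ENNReal.toReal_nonneg (by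
        by_contra! h
        nlinarith), h2]
      rw [h2] at h1
      linear_combination -(μ Set.univ).toReal * h1
    · have h := hmul (P j)
      rw [hLP, if_neg (Ne.symm hj)] at h
      simpa [hc0.ne'] using h.symm
  have hcard : (P n).roots.toFinset.card = n := by
    rw [Multiset.toFinset_card_of_nodup (nodup_roots_of_orthogonal hmom hpd (hP0 n) hPn),
      ← (splits_of_orthogonal hmom hpd (hP0 n) hPn).natDegree_eq_card_roots,
      natDegree_eq_of_degree_eq_some (hdeg n)]
  set x : Fin n → ℝ := ⇑((P n).roots.toFinset.orderEmbOfFin hcard)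
  have hmono : StrictMono x := OrderEmbedding.strictMono _
  have hroot : ∀ q, (P n).eval (x q) = 0 := fun q => by
    have := Finset.orderEmbOfFin_mem (P n).roots.toFinset hcard q
    rw [Multiset.mem_toFinset, mem_roots (hP0 n)] at this
    exact this
  have hinj : Set.InjOn x (Finset.univ : Finset (Fin n)) := hmono.injective.injOn
  have hexact : ∀ w : Fin n → ℝ, (∀ j : Fin n, ∑ q, (P (j : ℕ)).eval (x q) * w q =
      if (j : ℕ) = 0 then Real.sqrt (μ Set.univ).toReal else 0) →
      ∀ p : ℝ[X], p.degree < (n : WithBot ℕ) → L p = ∑ q, w q * p.eval (x q) := by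
    intro w hw p hp
    have := linearMap_eq_zero_of_degree_lt hdeg (L - ∑ q, w q • leval (x q)) n (fun j hj => ?_) p hp
    · simpa [sub_eq_zero] using this
    · have := hw ⟨j, hj⟩
      simp only [mul_comm _ (w _)] at this
      simp [hLPj, this]
  have hbasis : ∀ q, (Lagrange.basis Finset.univ x q).degree = ((n - 1 : ℕ) : WithBot ℕ) :=
    fun q => by simpa using Lagrange.degree_basis hinj (Finset.mem_univ q)
  have hevbasis : ∀ (w : Fin n → ℝ) (k : ℕ) (q : Fin n), k ≠ 0 →
      ∑ r, w r * (Lagrange.basis Finset.univ x q).eval (x r) ^ k = w q := fun w k q hk => by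
    rw [Finset.sum_eq_single q]
    · simp [Lagrange.eval_basis_self hinj (Finset.mem_univ q)]
    · intro r _ hr
      simp [Lagrange.eval_basis_of_ne hr.symm (Finset.mem_univ r), hk]
    · simp
  refine ⟨x, hmono, hroot, fun q => ?_, ⟨fun q => L (Lagrange.basis Finset.univ x q), ?_, ?_⟩, ?_⟩
  · have := root_mem_interior_of_orthogonal hmom hpd (hP0 n) hPn (hroot q)
    convert this using 3
    ext y
    exact (Measure.mem_support_iff_forall y).symm
  · intro j
    rw [← hLPj]
    have h : (P j).degree < (Finset.univ : Finset (Fin n)).card := by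
      rw [hdeg]; simp
    conv_rhs => rw [Lagrange.eq_interpolate hinj h, Lagrange.interpolate_apply]
    simp [← smul_eq_C_mul]
  · intro w hw
    ext q
    have h := hexact w hw (Lagrange.basis Finset.univ x q) (by
      rw [hbasis]; exact_mod_cast (by omega))
    simpa using (h.trans (by simpa using hevbasis w 1 q one_ne_zero)).symm
  · intro w hw
    have hgauss : ∀ p : ℝ[X], p.natDegree ≤ 2 * n - 1 →
        L p = ∑ q, w q * p.eval (x q) := fun p hp => by
      have hmod := EuclideanDomain.div_add_mod p (P n)
      have hnd : (P n).natDegree = n := natDegree_eq_of_degree_eq_some (hdeg n)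
      have hq : (p / P n).degree < (P n).degree := by
        rw [hdeg]
        refine degree_le_natDegree.trans_lt (Nat.cast_lt.2 ?_)
        have := natDegree_div_le_sub p (hP0 n)
        omega
      have hr : (p % P n).degree < (n : WithBot ℕ) := by
        rw [← hdeg n]; exact EuclideanDomain.mod_lt p (hP0 n)
      have hev : ∀ q, p.eval (x q) = (p % P n).eval (x q) := fun q => by
        conv_lhs => rw [← hmod]
        simp [hroot]
      simp only [hev]
      rw [← hexact w hw _ hr]
      conv_lhs => rw [← hmod]
      rw [map_add, hPn _ hq, zero_add]
    refine ⟨fun q => ?_, hgauss⟩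
    have hb0 := Lagrange.basis_ne_zero hinj (Finset.mem_univ q)
    have h := hgauss (Lagrange.basis Finset.univ x q ^ 2) (by
      rw [natDegree_pow, natDegree_eq_of_degree_eq_some (hbasis q)]; omega)
    simp only [eval_pow, hevbasis w 2 q two_ne_zero] at h
    rw [← h, hL, momentFunctional_apply]
    simpa only [eval_pow] using hpd _ hb0
end

section
/- Let n ≥ 1 and let l_n denote the degree-n Legendre polynomial on [−1,1]. Suppose q is a real polynomial of degree n+1 such that the degree-(2n+1) polynomial k := l_n · q satisfies ∫_{−1}^{1} k(x) x^i dx = 0 for all i = 0,…,n, and suppose k has 2n+1 distinct real roots x₁ < … < x_{2n+1}, all contained in [−1,1], whose node set is symmetric about the origin (x_i = −x_{2n+2−i} for all i). Let w₁,…,w_{2n+1} be the interpolatory weights, i.e. w_i = ∫_{−1}^{1} L_i(x) dx where L_i is the Lagrange basis polynomial equal to 1 at x_i and 0 at the other nodes. Then ∫_{−1}^{1} f(x) dx = Σ_{i=1}^{2n+1} w_i f(x_i) holds for every real polynomial f of degree at most 3n+1 if n is even, and for every real polynomial f of degree at most 3n+2 if n is odd. -/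
open Polynomial intervalIntegral

/-- A polynomial whose moments vanish up to order `m` is orthogonal to all polynomials of degree
at most `m`. -/
theorem integral_eval_mul_eq_zero_of_moments {a b : ℝ} {k s : Polynomial ℝ} {m : ℕ}
    (hs : s.natDegree ≤ m)
    (h : ∀ i ≤ m, ∫ t in a..b, k.eval t * t ^ i = 0) :
    ∫ t in a..b, (k * s).eval t = 0 := by
  have h1 : ∀ t : ℝ, (k * s).eval t =
      ∑ i ∈ Finset.range (m + 1), s.coeff i * (k.eval t * t ^ i) := by
    intro t
    rw [eval_mul, eval_eq_sum_range' (Nat.lt_succ_of_le hs), Finset.mul_sum]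
    exact Finset.sum_congr rfl fun i _ => by ring
  simp_rw [h1]
  rw [integral_finsetSum fun i _ =>
    Continuous.intervalIntegrable (by fun_prop) _ _]
  refine Finset.sum_eq_zero fun i hi => ?_
  rw [intervalIntegral.integral_const_mul, h i (by simpa [Nat.lt_succ_iff] using hi), mul_zero]

/-- An interpolatory quadrature rule on `m` distinct nodes is exact in degree less than `m`. -/
theorem integral_eval_eq_sum_interpolatory_weights {m : ℕ} {a b : ℝ} {x : Fin m → ℝ}
    (hx : Function.Injective x) {r : Polynomial ℝ} (hr : r.degree < m) :
    ∫ t in a..b, r.eval t =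
      ∑ i, (∫ t in a..b, (Lagrange.basis Finset.univ x i).eval t) * r.eval (x i) := by
  have h1 : ∀ t : ℝ, r.eval t =
      ∑ i, (Lagrange.basis Finset.univ x i).eval t * r.eval (x i) := by
    intro t
    conv_lhs => rw [Lagrange.eq_interpolate (s := Finset.univ) (v := x) (f := r) hx.injOn
      (by simpa using hr)]
    simp [Lagrange.interpolate_apply, eval_finsetSum, mul_comm]
  rw [intervalIntegral.integral_congr fun t _ => h1 t]
  rw [integral_finsetSum fun i _ =>
    Continuous.intervalIntegrable (by fun_prop) _ _]
  simp

/-- A polynomial of odd degree `m` vanishing at `m` distinct points placed symmetrically about the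
origin is an odd function. -/
theorem eval_neg_of_symmetric_roots {m : ℕ} (hm : Odd m) {k : Polynomial ℝ}
    (hk : k.natDegree ≤ m) {x : Fin m → ℝ} (hx : Function.Injective x)
    (hroots : ∀ i, k.eval (x i) = 0) (hsym : ∀ i, x i = -x i.rev) (t : ℝ) :
    k.eval (-t) = -k.eval t := by
  have h0 : k + k.comp (C (-1) * X) = 0 := by
    refine eq_zero_of_degree_lt_of_eval_index_eq_zero Finset.univ (v := x) hx.injOn ?_ ?_
    · rw [Finset.card_univ, Fintype.card_fin, degree_lt_iff_coeff_zero]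
      intro j hj
      rcases hj.eq_or_lt with rfl | hj
      · rw [coeff_add, comp_C_mul_X_coeff, hm.neg_one_pow, mul_neg_one, add_neg_cancel]
      · rw [coeff_add, comp_C_mul_X_coeff, coeff_eq_zero_of_natDegree_lt (hk.trans_lt hj),
          zero_mul, add_zero]
    · intro i _
      have : -x i = x i.rev := by rw [hsym i, neg_neg]
      simp [eval_comp, hroots, this]
  have h1 := congrArg (eval t) h0
  simp only [eval_add, eval_comp, eval_mul, eval_C, eval_X, eval_zero, neg_one_mul] at h1
  linarith

theorem integral_eq_zero_of_odd {g : ℝ → ℝ} (hg : ∀ t, g (-t) = -g t) (a : ℝ) :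
    ∫ t in (-a)..a, g t = 0 := by
  have h := integral_comp_neg (a := -a) (b := a) g
  simp only [hg, intervalIntegral.integral_neg, neg_neg] at h
  linarith

theorem stmt_1 (n : ℕ) (hn : 1 ≤ n)
    (l : Polynomial ℝ) (hl0 : l ≠ 0) (hldeg : l.degree = (n : WithBot ℕ))
    (hlorth : ∀ i < n, ∫ t in (-1 : ℝ)..1, l.eval t * t ^ i = 0)
    (q : Polynomial ℝ) (hqdeg : q.degree = ((n + 1 : ℕ) : WithBot ℕ))
    (k : Polynomial ℝ) (hk : k = l * q)
    (hkorth : ∀ i ≤ n, ∫ t in (-1 : ℝ)..1, k.eval t * t ^ i = 0)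
    (x : Fin (2 * n + 1) → ℝ) (hmono : StrictMono x)
    (hroots : ∀ i, k.eval (x i) = 0)
    (hin : ∀ i, x i ∈ Set.Icc (-1 : ℝ) 1)
    (hsym : ∀ i, x i = -x i.rev)
    (w : Fin (2 * n + 1) → ℝ)
    (hw : ∀ i, w i = ∫ t in (-1 : ℝ)..1, (Lagrange.basis Finset.univ x i).eval t) :
    ∀ f : Polynomial ℝ,
      f.natDegree ≤ (if Even n then 3 * n + 1 else 3 * n + 2) →
      ∫ t in (-1 : ℝ)..1, f.eval t = ∑ i, w i * f.eval (x i) := by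
  intro f hf
  have hkdeg : k.natDegree = 2 * n + 1 := by
    have hq0 : q ≠ 0 := by
      rintro rfl
      exact WithBot.bot_ne_coe (degree_zero.symm.trans hqdeg)
    rw [hk, natDegree_mul hl0 hq0, natDegree_eq_of_degree_eq_some hldeg,
      natDegree_eq_of_degree_eq_some hqdeg]
    omega
  have hk0 : k ≠ 0 := by
    rintro rfl
    simp at hkdeg
  have hks : ∫ t in (-1 : ℝ)..1, (k * (f / k)).eval t = 0 := by
    have hdiv : (f / k).natDegree = f.natDegree - k.natDegree := by
      rw [div_def, natDegree_C_mul (inv_ne_zero (leadingCoeff_ne_zero.mpr hk0)),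
        natDegree_divByMonic _ (monic_mul_leadingCoeff_inv hk0),
        natDegree_mul_leadingCoeff_inv _ hk0]
    split_ifs at hf with hpar
    · exact integral_eval_mul_eq_zero_of_moments (m := n) (by omega) hkorth
    · refine integral_eval_mul_eq_zero_of_moments (m := n + 1) (by omega) fun i hi => ?_
      rcases hi.eq_or_lt with rfl | hi
      · refine integral_eq_zero_of_odd (fun t => ?_) 1
        have hev : Even (n + 1) := (Nat.not_even_iff_odd.mp hpar).add_one
        rw [hev.neg_pow, eval_neg_of_symmetric_roots (odd_two_mul_add_one n) hkdeg.le
          hmono.injective hroots hsym, neg_mul]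
      · exact hkorth i (by omega)
  have hr : (f % k).degree < ((2 * n + 1 : ℕ) : WithBot ℕ) := by
    rw [← hkdeg, ← degree_eq_natDegree hk0]
    exact degree_mod_lt f hk0
  have hsplit : ∀ t, f.eval t = (k * (f / k)).eval t + (f % k).eval t := fun t => by
    rw [← eval_add, EuclideanDomain.div_add_mod]
  have hnode : ∀ i, f.eval (x i) = (f % k).eval (x i) := fun i => by
    rw [hsplit, eval_mul, hroots, zero_mul, zero_add]
  simp only [hnode, hw]
  simp only [hsplit]
  rw [intervalIntegral.integral_add (Polynomial.continuous _ |>.intervalIntegrable _ _)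
    (Polynomial.continuous _ |>.intervalIntegrable _ _), hks, zero_add]
  exact integral_eval_eq_sum_interpolatory_weights hmono.injective hr
end
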